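/- arXiv:2603.01536 — 2 statements merged into one kernel-verified Lean document; each statement's English description precedes it below -/
import Mathlib

section
/- Under the stated setup, the doubly projected covariance matrix satisfies the identity P_vᵀ C P_t = U Σ̃ Wᵀ, where Σ̃ is the d×d diagonal matrix whose i-th diagonal entry equals (1 − λ)² σ_i for i ≤ k and equals σ_i for i > k. In particular, applying the soft null-space projections scales the top-k singular directions of C by the factor (1 − λ)² while leaving the remaining directions unchanged. -/
open Matrix Finset

/-- The first `k` columns of `V` times their transpose equal `V` times a truncated identity
times `Vᵀ`. -/
theorem submatrix_castLE_mul_transpose {R : Type*} [CommRing R] {d k : ℕ} (hk : k ≤ d)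
    (V : Matrix (Fin d) (Fin d) R) :
    V.submatrix id (Fin.castLE hk) * (V.submatrix id (Fin.castLE hk))ᵀ =
      V * Matrix.diagonal (fun i : Fin d => if (i : ℕ) < k then 1 else 0) * Vᵀ := by
  ext a b
  obtain ⟨m, rfl⟩ := Nat.exists_eq_add_of_le hk
  rw [Matrix.mul_apply, Matrix.mul_apply, Fin.sum_univ_add]
  simp [Matrix.mul_diagonal, Fin.castAdd]

/-- A soft projection along the first `k` columns of an orthogonal matrix is diagonal in the
corresponding basis. -/
theorem soft_projection_eq {R : Type*} [CommRing R] {d k : ℕ} (hk : k ≤ d) (c : R)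
    {V : Matrix (Fin d) (Fin d) R} (hV : Vᵀ * V = 1) :
    1 - c • (V.submatrix id (Fin.castLE hk) * (V.submatrix id (Fin.castLE hk))ᵀ) =
      V * Matrix.diagonal (fun i : Fin d => if (i : ℕ) < k then 1 - c else 1) * Vᵀ := by
  have hdiag : Matrix.diagonal (fun i : Fin d => if (i : ℕ) < k then 1 - c else 1) =
      1 - c • Matrix.diagonal (fun i : Fin d => if (i : ℕ) < k then (1 : R) else 0) := by
    rw [← Matrix.diagonal_one, ← Matrix.diagonal_smul, Matrix.diagonal_sub]
    congr 1
    ext i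
    by_cases hi : (i : ℕ) < k <;> simp [hi]
  rw [submatrix_castLE_mul_transpose, hdiag, mul_sub, sub_mul, mul_one,
    mul_eq_one_comm.mp hV, Matrix.mul_smul, Matrix.smul_mul]

/-- **Singular Value Suppression.**  Given `d ≥ 1`, `1 ≤ k ≤ d`, `λ ∈ ℝ`, orthogonal
matrices `U, W` with `UᵀU = WᵀW = I`, singular values `σ₁,…,σ_d`, `Σ = diagonal σ`,
`C = U Σ Wᵀ`, and soft null-space projections `P_v = I − λ U_k U_kᵀ`,
`P_t = I − λ W_k W_kᵀ` (where `U_k`, `W_k` consist of the first `k` columns), we have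
`P_vᵀ C P_t = U Σ̃ Wᵀ`, where `Σ̃` is diagonal with entries `(1 − λ)² σ_i` for `i ≤ k`
and `σ_i` for `i > k`. -/
theorem singular_value_suppression
    (d k : ℕ) (hd : 1 ≤ d) (hk1 : 1 ≤ k) (hk : k ≤ d) (lam : ℝ)
    (U W : Matrix (Fin d) (Fin d) ℝ)
    (hU : Uᵀ * U = 1) (hW : Wᵀ * W = 1)
    (σ : Fin d → ℝ)
    (C : Matrix (Fin d) (Fin d) ℝ)
    (hC : C = U * Matrix.diagonal σ * Wᵀ)
    (Uk : Matrix (Fin d) (Fin k) ℝ) (hUk : Uk = U.submatrix id (Fin.castLE hk))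
    (Wk : Matrix (Fin d) (Fin k) ℝ) (hWk : Wk = W.submatrix id (Fin.castLE hk))
    (Pv Pt : Matrix (Fin d) (Fin d) ℝ)
    (hPv : Pv = 1 - lam • (Uk * Ukᵀ))
    (hPt : Pt = 1 - lam • (Wk * Wkᵀ)) :
    Pvᵀ * C * Pt =
      U * Matrix.diagonal (fun i : Fin d => if (i : ℕ) < k then (1 - lam) ^ 2 * σ i else σ i) * Wᵀ := by
  subst hC hUk hWk hPv hPt
  rw [soft_projection_eq hk lam hU, soft_projection_eq hk lam hW]
  set D : Matrix (Fin d) (Fin d) ℝ :=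
    Matrix.diagonal (fun i : Fin d => if (i : ℕ) < k then 1 - lam else 1) with hD
  have hDσ : D * Matrix.diagonal σ * D =
      Matrix.diagonal (fun i : Fin d => if (i : ℕ) < k then (1 - lam) ^ 2 * σ i else σ i) := by
    rw [hD, Matrix.diagonal_mul_diagonal, Matrix.diagonal_mul_diagonal]
    congr 1
    ext i
    split_ifs <;> ring
  calc (U * D * Uᵀ)ᵀ * (U * Matrix.diagonal σ * Wᵀ) * (W * D * Wᵀ)
      = U * D * (Uᵀ * U) * Matrix.diagonal σ * (Wᵀ * W) * D * Wᵀ := by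
        simp only [Matrix.transpose_mul, Matrix.transpose_transpose, hD,
          Matrix.diagonal_transpose, Matrix.mul_assoc]
    _ = U * (D * Matrix.diagonal σ * D) * Wᵀ := by
        simp only [hU, hW, mul_one, Matrix.mul_assoc]
    _ = _ := by rw [hDσ]
end

section
/- Let α, β be positive reals and let a, b, c be reals with a > 0, b ≥ 0, c ≥ 0, a ≥ b, a ≥ c, and α² b + β² c > 0. Then the ratio of redundant to modality-specific energy satisfies (α + β)² a / (α² b + β² c) ≥ 1 + 2αβ/(α² + β²), and the right-hand side is strictly greater than 1. -/
/-- **Imbalance Ratio.**  For positive fusion weights `α, β` and energies `a > 0`,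
`b, c ≥ 0` with `a ≥ b`, `a ≥ c` and `α² b + β² c > 0`, the ratio of redundant to
modality-specific energy satisfies
`(α + β)² a / (α² b + β² c) ≥ 1 + 2αβ/(α² + β²)`, and the right-hand side is
strictly greater than `1`. -/
theorem imbalance_ratio
    (α β a b c : ℝ)
    (hα : 0 < α) (hβ : 0 < β)
    (ha : 0 < a) (hb : 0 ≤ b) (hc : 0 ≤ c)
    (hab : b ≤ a) (hac : c ≤ a)
    (hpos : 0 < α ^ 2 * b + β ^ 2 * c) :
    1 + 2 * α * β / (α ^ 2 + β ^ 2) ≤ (α + β) ^ 2 * a / (α ^ 2 * b + β ^ 2 * c) ∧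
      1 < 1 + 2 * α * β / (α ^ 2 + β ^ 2) := by
  have hsq : 0 < α ^ 2 + β ^ 2 := by positivity
  refine ⟨?_, lt_add_of_pos_right 1 (by positivity)⟩
  have hle : α ^ 2 * b + β ^ 2 * c ≤ (α ^ 2 + β ^ 2) * a := by
    rw [add_mul]
    gcongr
  calc 1 + 2 * α * β / (α ^ 2 + β ^ 2)
      = (α + β) ^ 2 * a / ((α ^ 2 + β ^ 2) * a) := by
        field_simp
        ring
    _ ≤ (α + β) ^ 2 * a / (α ^ 2 * b + β ^ 2 * c) := by gcongr
end
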